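/- There exists a precise forecasting system φ for which every path ω ∈ Ω is C-random; moreover, any such precise forecasting system φ (one with respect to which every path is C-random) is necessarily non-stationary and non-computable. -/

import Mathlib

open Filter Classical

/-- Situations: finite binary strings. -/
abbrev Situation := List Bool

/-- Paths: infinite binary sequences. -/
abbrev BinPath := ℕ → Bool

/-- The length-`n` prefix `ω_{1:n}` of a path. -/
def pref (ω : BinPath) (n : ℕ) : Situation := List.ofFn (fun i : Fin n => ω i)

/-- The real value of a bit. -/
def bit (x : Bool) : ℝ := if x then 1 else 0

/-- Local expectation `E_p(f) = p f(1) + (1-p) f(0)` of a gamble `f : Bool → ℝ`. -/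
def localE (p : ℝ) (f : Bool → ℝ) : ℝ := p * f true + (1 - p) * f false

/-- Upper expectation of a gamble for interval forecast `[lo, hi]`. -/
def upperE (lo hi : ℝ) (f : Bool → ℝ) : ℝ := max (localE lo f) (localE hi f)

/-- A forecasting system, given by lower and upper bounds `lo hi : Situation → ℝ`,
is proper when `0 ≤ lo s ≤ hi s ≤ 1` everywhere. -/
def IsForecastingSystem (lo hi : Situation → ℝ) : Prop :=
  ∀ s, 0 ≤ lo s ∧ lo s ≤ hi s ∧ hi s ≤ 1

/-- The process difference `ΔF(s) : x ↦ F(s·x) − F(s)`. -/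
def diffP (F : Situation → ℝ) (s : Situation) : Bool → ℝ := fun x => F (s ++ [x]) - F s

/-- A supermartingale for the forecasting system `(lo, hi)`. -/
def IsSupermartingale (lo hi : Situation → ℝ) (F : Situation → ℝ) : Prop :=
  ∀ s, upperE (lo s) (hi s) (diffP F s) ≤ 0

/-- A test supermartingale: a nonnegative supermartingale starting at 1. -/
def IsTestSupermartingale (lo hi : Situation → ℝ) (F : Situation → ℝ) : Prop :=
  IsSupermartingale lo hi F ∧ (∀ s, 0 ≤ F s) ∧ F [] = 1

/-- A real process is (positive) rational-valued and recursive. -/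
def IsRecursiveRational (F : Situation → ℝ) : Prop :=
  ∃ q : Situation → ℚ, Computable q ∧ ∀ s, (q s : ℝ) = F s

/-- A real process is computable. -/
def IsComputableProcess (F : Situation → ℝ) : Prop :=
  ∃ q : Situation → ℕ → ℚ, Computable₂ q ∧
    ∀ s n, |F s - q s n| < (2 : ℝ) ^ (-(n : ℤ))

/-- A real process is lower semicomputable. -/
def IsLSCProcess (F : Situation → ℝ) : Prop :=
  ∃ q : Situation → ℕ → ℚ, Computable₂ q ∧
    (∀ s n, q s n ≤ q s (n + 1)) ∧
    ∀ s, Tendsto (fun m => (q s m : ℝ)) atTop (nhds (F s))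

/-- A (real) growth function: computable, nonnegative, nondecreasing and unbounded. -/
def IsGrowthFunction (τ : ℕ → ℝ) : Prop :=
  (∀ n, 0 ≤ τ n) ∧ (∀ n, τ n ≤ τ (n + 1)) ∧ Tendsto τ atTop atTop ∧
    ∃ q : ℕ → ℕ → ℚ, Computable₂ q ∧ ∀ n m, |τ n - q n m| < (2 : ℝ) ^ (-(m : ℤ))

/-- A real process is unbounded on a path: `limsup_n T(ω_{1:n}) = ∞`. -/
def UnboundedOn (T : Situation → ℝ) (ω : BinPath) : Prop :=
  limsup (fun n => ((T (pref ω n) : ℝ) : EReal)) atTop = ⊤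

/-- A real process is computably unbounded on a path:
`limsup_n [T(ω_{1:n}) − τ(n)] ≥ 0` for some growth function `τ`. -/
def ComputablyUnboundedOn (T : Situation → ℝ) (ω : BinPath) : Prop :=
  ∃ τ : ℕ → ℝ, IsGrowthFunction τ ∧
    0 ≤ limsup (fun n => ((T (pref ω n) - τ n : ℝ) : EReal)) atTop

/-- Computable randomness for the forecasting system `(lo, hi)`:
no recursive positive rational test supermartingale is unbounded on `ω`. -/
def CRandom (lo hi : Situation → ℝ) (ω : BinPath) : Prop :=
  ∀ T : Situation → ℝ, IsRecursiveRational T → (∀ s, 0 < T s) →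
    IsTestSupermartingale lo hi T → ¬ UnboundedOn T ω

/-- Schnorr randomness for the forecasting system `(lo, hi)`:
no recursive positive rational test supermartingale is computably unbounded on `ω`. -/
def SchnorrRandom (lo hi : Situation → ℝ) (ω : BinPath) : Prop :=
  ∀ T : Situation → ℝ, IsRecursiveRational T → (∀ s, 0 < T s) →
    IsTestSupermartingale lo hi T → ¬ ComputablyUnboundedOn T ω

/-- Martin-Löf randomness for the forecasting system `(lo, hi)`:
no lower semicomputable test supermartingale is unbounded on `ω`. -/
def MLRandom (lo hi : Situation → ℝ) (ω : BinPath) : Prop :=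
  ∀ T : Situation → ℝ, IsLSCProcess T →
    IsTestSupermartingale lo hi T → ¬ UnboundedOn T ω

/-- A selection process is temporal if its value depends only on the length. -/
def IsTemporal (S : Situation → Bool) : Prop :=
  ∀ s t : Situation, s.length = t.length → S s = S t

/-- Value of a selection process along a path. -/
def selVal (S : Situation → Bool) (ω : BinPath) (k : ℕ) : ℝ := if S (pref ω k) then 1 else 0

/-- `ω` is `𝒮`-random for the forecasting system `(lo, hi)`. -/
def SSetRandom (𝒮 : Set (Situation → Bool)) (lo hi : Situation → ℝ) (ω : BinPath) : Prop :=
  ∀ S ∈ 𝒮,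
    Tendsto (fun n => ∑ k ∈ Finset.range n, selVal S ω k) atTop atTop →
      0 ≤ liminf (fun n =>
          (((∑ k ∈ Finset.range n, selVal S ω k * (bit (ω k) - lo (pref ω k))) /
              (∑ k ∈ Finset.range n, selVal S ω k) : ℝ) : EReal)) atTop ∧
        limsup (fun n =>
          (((∑ k ∈ Finset.range n, selVal S ω k * (bit (ω k) - hi (pref ω k))) /
              (∑ k ∈ Finset.range n, selVal S ω k) : ℝ) : EReal)) atTop ≤ 0

/-- Weak Church randomness: the selection-process conditions hold for all
recursive temporal selection processes. -/
def WCHRandom (lo hi : Situation → ℝ) (ω : BinPath) : Prop :=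
  SSetRandom {S | Computable S ∧ IsTemporal S} lo hi ω

/-- Global upper expectation of a bounded global gamble `f : BinPath → ℝ`. -/
noncomputable def globalUpperE (lo hi : Situation → ℝ) (f : BinPath → ℝ) : ℝ :=
  sInf {m : ℝ | ∃ M : Situation → ℝ, IsSupermartingale lo hi M ∧ M [] = m ∧
    ∀ ω : BinPath, (f ω : EReal) ≤ liminf (fun n => ((M (pref ω n) : ℝ) : EReal)) atTop}

/-- Upper probability of an event. -/
noncomputable def upperProb (lo hi : Situation → ℝ) (A : Set BinPath) : ℝ :=
  globalUpperE lo hi (Set.indicator A 1)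

/-- An event is almost sure if its complement has upper probability zero. -/
def AlmostSure (lo hi : Situation → ℝ) (A : Set BinPath) : Prop :=
  upperProb lo hi Aᶜ = 0

/-- The set of recursive positive rational test processes `𝓕_C`. -/
def FsetC : Set (Situation → ℝ) :=
  {F | IsRecursiveRational F ∧ (∀ s, 0 < F s) ∧ F [] = 1}

/-- The set of lower semicomputable test processes `𝓕_ML`. -/
def FsetML : Set (Situation → ℝ) :=
  {F | IsLSCProcess F ∧ (∀ s, 0 ≤ F s) ∧ F [] = 1}

/-- The temporal selection process `S^r_F` associated with a real process `F`
and a number `r`. -/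
noncomputable def selProc (r : ℝ) (F : Situation → ℝ) : Situation → Bool := fun s =>
  if ∃ t : Situation, t.length = s.length ∧ 0 < localE r (diffP F t) then true else false

/-- The set of selection processes `𝒮^{p,q}_𝓕`. -/
def SelSet (p q : ℝ) (𝓕 : Set (Situation → ℝ)) : Set (Situation → Bool) :=
  {S | ∃ F ∈ 𝓕, ∃ r ∈ ({p, q} : Set ℝ), S = selProc r F}

/-- The temporal precise forecasting system `φ^ϖ_{p,q}`. -/
def tempFS (p q : ℝ) (ϖ : BinPath) : Situation → ℝ := fun s => if ϖ s.length then q else p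

/-- A test process `F` is generated by the multiplier process `D`. -/
def GeneratedBy (D : Situation → Bool → ℝ) (F : Situation → ℝ) : Prop :=
  F [] = 1 ∧ ∀ s x, F (s ++ [x]) = F s * D s x

/-- A lower semicomputable multiplier process: a nonnegative gamble process that
is lower semicomputable. -/
def IsLSCMultiplier (D : Situation → Bool → ℝ) : Prop :=
  (∀ s x, 0 ≤ D s x) ∧
  ∃ q : Situation → Bool → ℕ → ℚ,
    Computable (fun p : Situation × Bool × ℕ => q p.1 p.2.1 p.2.2) ∧
    (∀ s x n, q s x n ≤ q s x (n + 1)) ∧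
    ∀ s x, Tendsto (fun m => (q s x m : ℝ)) atTop (nhds (D s x))

/-! ### Computability of the rational encoding -/

/-- The raw (non-surjective) code of a rational number. -/
def ratCode (q : ℚ) : ℕ := Nat.pair (Equiv.intEquivNat q.num) q.den

theorem ratCode_eq (q : ℚ) : ratCode q = @Encodable.encode ℚ Rat.instEncodable q := rfl

/-- The code of a rational in the denumeration underlying `Primcodable ℚ`. -/
def ratEnc (q : ℚ) : ℕ := @Encodable.encode ℚ (Primcodable.ofDenumerable ℚ).toEncodable q

theorem ofNat_ratEnc (q : ℚ) : Denumerable.ofNat ℚ (ratEnc q) = q := Denumerable.ofNat_encode q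

theorem ratCode_injective : Function.Injective ratCode := by
  intro a b h
  exact @Encodable.encode_injective ℚ Rat.instEncodable a b h

theorem ratCode_ofNat_strictMono :
    StrictMono (fun n : ℕ => ratCode (Denumerable.ofNat ℚ n)) := by
  let _ := @Encodable.decidableRangeEncode ℚ Rat.instEncodable
  let _ : Infinite (Set.range (@Encodable.encode ℚ Rat.instEncodable)) :=
    Infinite.of_injective _ (Equiv.ofInjective _ Encodable.encode_injective).injective
  have key : ∀ n : ℕ, ratCode (Denumerable.ofNat ℚ n) =
      (Nat.Subtype.ofNat (Set.range (@Encodable.encode ℚ Rat.instEncodable)) n).1 := by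
    intro n
    have h : Denumerable.ofNat ℚ n = (@Encodable.equivRangeEncode ℚ Rat.instEncodable).symm
      (Nat.Subtype.ofNat (Set.range (@Encodable.encode ℚ Rat.instEncodable)) n) := rfl
    rw [h]
    exact congrArg Subtype.val ((@Encodable.equivRangeEncode ℚ Rat.instEncodable).apply_symm_apply
      (Nat.Subtype.ofNat (Set.range (@Encodable.encode ℚ Rat.instEncodable)) n))
  refine strictMono_nat_of_lt_succ fun n => ?_
  simp only [key]
  exact Nat.Subtype.lt_succ_self _

/-- The natural numbers that are raw codes of rationals. -/
def IsRatCode (m : ℕ) : Prop :=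
  0 < m.unpair.2 ∧ ∀ d < m.unpair.2 + 1,
    d = 1 ∨ ¬ (((m.unpair.1 + 1) / 2) % d = 0 ∧ m.unpair.2 % d = 0)

theorem intEquivNat_natCast (n : ℕ) : Equiv.intEquivNat (n : ℤ) = 2 * n := by
  change Equiv.intEquivNat (Int.ofNat n) = 2 * n
  simp [Equiv.intEquivNat, Equiv.intEquivNatSumNat, -Int.ofNat_eq_natCast]

theorem intEquivNat_negSucc (n : ℕ) : Equiv.intEquivNat (Int.negSucc n) = 2 * n + 1 := by
  simp [Equiv.intEquivNat, Equiv.intEquivNatSumNat]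

theorem half_intEquivNat (z : ℤ) : (Equiv.intEquivNat z + 1) / 2 = z.natAbs := by
  rcases z with n | n
  · rw [Int.ofNat_eq_natCast, intEquivNat_natCast]; simp; omega
  · rw [intEquivNat_negSucc]; simp; omega

theorem isRatCode_iff (m : ℕ) : IsRatCode m ↔ ∃ n : ℕ, ratCode (Denumerable.ofNat ℚ n) = m := by
  constructor
  · rintro ⟨h0, h⟩
    have hz := half_intEquivNat (Equiv.intEquivNat.symm m.unpair.1)
    rw [Equiv.apply_symm_apply] at hz
    have hc : (Equiv.intEquivNat.symm m.unpair.1).natAbs.Coprime m.unpair.2 := by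
      rw [← hz]
      have hd := Nat.gcd_dvd_right ((m.unpair.1 + 1) / 2) m.unpair.2
      have hd' := Nat.gcd_dvd_left ((m.unpair.1 + 1) / 2) m.unpair.2
      rcases h _ (Nat.lt_succ_of_le (Nat.le_of_dvd h0 hd)) with h1 | h1
      · exact h1
      · exact absurd ⟨Nat.mod_eq_zero_of_dvd hd', Nat.mod_eq_zero_of_dvd hd⟩ h1
    let q : ℚ := ⟨Equiv.intEquivNat.symm m.unpair.1, m.unpair.2, h0.ne', hc⟩
    refine ⟨ratEnc q, ?_⟩
    rw [ofNat_ratEnc]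
    simp [ratCode, q]
  · rintro ⟨n, rfl⟩
    set q := Denumerable.ofNat ℚ n
    simp only [IsRatCode, ratCode, Nat.unpair_pair, half_intEquivNat]
    refine ⟨q.den_pos, fun d _ => ?_⟩
    by_contra hcon
    push Not at hcon
    exact hcon.1 (Nat.eq_one_of_dvd_coprimes q.reduced (Nat.dvd_of_mod_eq_zero hcon.2.1)
      (Nat.dvd_of_mod_eq_zero hcon.2.2))

theorem isRatCode_primrec : PrimrecPred IsRatCode := by
  have hden : Primrec fun m : ℕ => m.unpair.2 := Primrec.snd.comp Primrec.unpair
  have hnum : Primrec fun m : ℕ => (m.unpair.1 + 1) / 2 :=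
    Primrec.nat_div.comp (Primrec.succ.comp (Primrec.fst.comp Primrec.unpair)) (Primrec.const 2)
  have h1 : PrimrecPred fun m : ℕ => 0 < m.unpair.2 := Primrec.nat_lt.comp (Primrec.const 0) hden
  have hR : PrimrecRel fun d m : ℕ =>
      d = 1 ∨ ¬ (((m.unpair.1 + 1) / 2) % d = 0 ∧ m.unpair.2 % d = 0) := by
    have a1 : PrimrecPred fun p : ℕ × ℕ => p.1 = 1 := Primrec.eq.comp Primrec.fst (Primrec.const 1)
    have a2 : PrimrecPred fun p : ℕ × ℕ => ((p.2.unpair.1 + 1) / 2) % p.1 = 0 :=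
      Primrec.eq.comp (Primrec.nat_mod.comp (hnum.comp Primrec.snd) Primrec.fst) (Primrec.const 0)
    have a3 : PrimrecPred fun p : ℕ × ℕ => p.2.unpair.2 % p.1 = 0 :=
      Primrec.eq.comp (Primrec.nat_mod.comp (hden.comp Primrec.snd) Primrec.fst) (Primrec.const 0)
    exact a1.or (a2.and a3).not
  exact h1.and (hR.forall_lt.comp (Primrec.succ.comp hden) Primrec.id)

theorem count_primrec {p : ℕ → Prop} [DecidablePred p] (hp : PrimrecPred p) :
    Primrec (Nat.count p) := by
  have hg : Primrec₂ fun (n : ℕ) (c : ℕ) => c + if p n then 1 else 0 :=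
    Primrec.nat_add.comp Primrec.snd
      (Primrec.ite (hp.comp Primrec.fst) (Primrec.const 1) (Primrec.const 0))
  refine (Primrec.nat_rec₁ 0 hg).of_eq fun n => ?_
  induction n with
  | zero => simp
  | succ n ih => rw [Nat.count_succ, ← ih]

theorem ratCode_count (n : ℕ) : Nat.count IsRatCode (ratCode (Denumerable.ofNat ℚ n)) = n := by
  have hr : Set.range (fun n : ℕ => ratCode (Denumerable.ofNat ℚ n)) = {m | IsRatCode m} := by
    ext m; exact (isRatCode_iff m).symm
  have hinf : {m | IsRatCode m}.Infinite := by
    rw [← hr]; exact Set.infinite_range_of_injective ratCode_ofNat_strictMono.injective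
  have he : (fun n : ℕ => ratCode (Denumerable.ofNat ℚ n)) = Nat.nth IsRatCode := by
    refine (StrictMono.range_inj ratCode_ofNat_strictMono (Nat.nth_strictMono hinf)).1 ?_
    rw [hr, Nat.range_nth_of_infinite hinf]
  have : ratCode (Denumerable.ofNat ℚ n) = Nat.nth IsRatCode n := congrFun he n
  rw [this, Nat.count_nth_of_infinite hinf]

theorem ratCode_isRatCode (q : ℚ) : IsRatCode (ratCode q) :=
  (isRatCode_iff _).2 ⟨ratEnc q, by rw [ofNat_ratEnc]⟩

theorem encode_eq_count (q : ℚ) : ratEnc q = Nat.count IsRatCode (ratCode q) := by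
  have := ratCode_count (ratEnc q)
  rw [ofNat_ratEnc] at this
  exact this.symm

theorem computable_of_ratCode {α : Type*} [Primcodable α] {f : α → ℚ}
    (hf : Computable fun a => ratCode (f a)) : Computable f := by
  rw [← Computable.encode_iff]
  exact ((count_primrec isRatCode_primrec).to_comp.comp hf).of_eq fun a =>
    (encode_eq_count (f a)).symm

theorem ratCode_computable : Computable ratCode := by
  have hP : Primrec₂ fun (q : ℚ) (m : ℕ) =>
      decide (IsRatCode m ∧ Nat.count IsRatCode m = ratEnc q) := by
    have h1 : PrimrecPred fun p : ℚ × ℕ => IsRatCode p.2 := isRatCode_primrec.comp Primrec.snd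
    have h2 : PrimrecPred fun p : ℚ × ℕ => Nat.count IsRatCode p.2 = ratEnc p.1 :=
      Primrec.eq.comp ((count_primrec isRatCode_primrec).comp Primrec.snd)
        (Primrec.encode.comp Primrec.fst)
    exact Primrec₂.mk (primrecPred_iff_primrec_decide.1 (h1.and h2))
  refine (Partrec.rfind hP.to_comp.partrec₂).of_eq_tot fun q => ?_
  rw [Nat.mem_rfind]
  constructor
  · simp [ratCode_isRatCode, encode_eq_count]
  · intro m hm
    simp only [PFun.coe_val, Part.mem_some_iff]
    symm
    rw [decide_eq_false_iff_not, encode_eq_count]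
    rintro ⟨h1, h2⟩
    exact hm.ne (Nat.count_injective h1 (ratCode_isRatCode q) h2)

/-! ### Betting against a forecasting system -/

/-- Number of correct guesses of `b` among the first `n` bits of `s`. -/
noncomputable def hits (b : Situation → Bool) (s : Situation) (n : ℕ) : ℕ :=
  Nat.rec 0 (fun i c => c + bif (s[i]? == some (b (s.take i))) then 1 else 0) n

theorem hits_computable {b : Situation → Bool} (hb : Computable b) :
    Computable fun s => hits b s s.length := by
  unfold hits
  refine Computable.nat_rec (h := fun (s : Situation) (p : ℕ × ℕ) =>
    p.2 + bif (s[p.1]? == some (b (s.take p.1))) then 1 else 0)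
    (Computable.list_length (α := Bool)) (Computable.const 0) ?_
  have hc : Computable fun p : Situation × ℕ × ℕ => p.2.2 := Computable.snd.comp Computable.snd
  refine Computable₂.mk (Primrec.nat_add.to_comp.comp hc ?_)
  refine Computable.cond ?_ (Computable.const 1) (Computable.const 0)
  have hi : Computable fun p : Situation × ℕ × ℕ => p.2.1 := Computable.fst.comp Computable.snd
  have hl : Computable fun p : Situation × ℕ × ℕ => p.1 := Computable.fst
  have hs := Computable.option_some.comp (hb.comp (Primrec.list_take.to_comp.comp hi hl))
  refine (Primrec.beq.to_comp.comp (Computable.list_getElem?.comp hl hi) hs).of_eq fun p => ?_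
  rw [Bool.eq_iff_iff]
  exact (@beq_iff_eq _ instBEqOfDecidableEq _ _ _).trans beq_iff_eq.symm

theorem hits_append (b : Situation → Bool) (s : Situation) (x : Bool) (n : ℕ)
    (hn : n ≤ s.length) : hits b (s ++ [x]) n = hits b s n := by
  induction n with
  | zero => rfl
  | succ n ih =>
    have ih := ih (by omega)
    simp only [hits] at ih ⊢
    rw [ih, List.getElem?_append_left (by omega), List.take_append_of_le_length (by omega)]

theorem hits_snoc (b : Situation → Bool) (s : Situation) (x : Bool) :
    hits b (s ++ [x]) (s ++ [x]).length =
      hits b s s.length + bif (x == b s) then 1 else 0 := by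
  have h := hits_append b s x s.length le_rfl
  rw [List.length_append, List.length_singleton]
  simp only [hits] at h ⊢
  rw [h]
  simp

/-- The capital process that always stakes on the guess of `b`. -/
noncomputable def betQ (b : Situation → Bool) (s : Situation) : ℚ :=
  5 ^ hits b s s.length / 4 ^ s.length

theorem ratCode_betQ (b : Situation → Bool) (s : Situation) :
    ratCode (betQ b s) = Nat.pair (2 * 5 ^ hits b s s.length) (4 ^ s.length) := by
  have hc : (((5 ^ hits b s s.length : ℕ) : ℤ)).natAbs.Coprime (4 ^ s.length) := by
    rw [Int.natAbs_natCast]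
    exact Nat.Coprime.pow _ _ (by norm_num)
  have : betQ b s = ⟨((5 ^ hits b s s.length : ℕ) : ℤ), 4 ^ s.length, by positivity, hc⟩ := by
    rw [Rat.mk_eq_divInt, Rat.divInt_eq_div, betQ]
    push_cast
    rfl
  rw [this, ratCode, intEquivNat_natCast]

theorem nat_pow_primrec : Primrec₂ ((· ^ ·) : ℕ → ℕ → ℕ) := Primrec₂.unpaired'.1 Nat.Primrec.pow

theorem betQ_computable {b : Situation → Bool} (hb : Computable b) : Computable (betQ b) := by
  apply computable_of_ratCode
  simp only [ratCode_betQ]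
  refine Primrec₂.natPair.to_comp.comp ?_ ?_
  · exact Primrec.nat_mul.to_comp.comp (Computable.const 2)
      (nat_pow_primrec.to_comp.comp (Computable.const 5) (hits_computable hb))
  · exact nat_pow_primrec.to_comp.comp (Computable.const 4) Computable.list_length

theorem betQ_snoc (b : Situation → Bool) (s : Situation) (x : Bool) :
    betQ b (s ++ [x]) = betQ b s * if x = b s then 5 / 4 else 1 / 4 := by
  unfold betQ
  rw [hits_snoc, List.length_append, List.length_singleton]
  by_cases h : x = b s
  · simp [h, pow_succ]; ring
  · have h' : (x == b s) = false := by simpa using h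
    simp [h, h', pow_succ]; ring

theorem betQ_pos (b : Situation → Bool) (s : Situation) : 0 < betQ b s := by
  unfold betQ; positivity

/-- Initial segments of the path following the guesses of `b`. -/
def follow (b : Situation → Bool) : ℕ → Situation
  | 0 => []
  | n + 1 => follow b n ++ [b (follow b n)]

theorem pref_succ (ω : BinPath) (n : ℕ) : pref ω (n + 1) = pref ω n ++ [ω n] := by
  unfold pref
  rw [List.ofFn_succ', List.concat_eq_append]
  simp

theorem pref_follow (b : Situation → Bool) (n : ℕ) :
    pref (fun k => b (follow b k)) n = follow b n := by
  induction n with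
  | zero => simp [pref, follow]
  | succ n ih => rw [pref_succ, ih, follow]

theorem betQ_follow (b : Situation → Bool) (n : ℕ) : betQ b (follow b n) = (5 / 4) ^ n := by
  induction n with
  | zero => simp [betQ, follow, hits]
  | succ n ih => rw [follow, betQ_snoc, ih, pow_succ]; simp

theorem not_all_random (φ : Situation → ℝ) (b : Situation → Bool)
    (hb : Computable b) (h1 : ∀ s, b s = true → φ s ≤ 3 / 4)
    (h0 : ∀ s, b s = false → 1 / 4 ≤ φ s) :
    ¬ ∀ ω : BinPath, CRandom φ φ ω := by
  intro H
  refine H (fun k => b (follow b k)) (fun s => (betQ b s : ℝ)) ⟨betQ b, betQ_computable hb,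
    fun _ => rfl⟩ (fun s => by exact_mod_cast betQ_pos b s) ⟨?_, ?_, ?_⟩ ?_
  · intro s
    have hp : (0 : ℝ) < betQ b s := by exact_mod_cast betQ_pos b s
    simp only [upperE, max_self, localE, diffP, betQ_snoc]
    cases hs : b s
    · have := h0 s hs
      simp
      nlinarith
    · have := h1 s hs
      simp
      nlinarith
  · intro s
    have : (0 : ℝ) < betQ b s := by exact_mod_cast betQ_pos b s
    exact this.le
  · simp [betQ, hits]
  · unfold UnboundedOn
    refine Tendsto.limsup_eq ?_
    rw [EReal.tendsto_coe_nhds_top_iff]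
    simp only [pref_follow, betQ_follow]
    push_cast
    exact tendsto_pow_atTop_atTop_of_one_lt (by norm_num)

theorem rat_le_half_iff (q : ℚ) : q ≤ 1 / 2 ↔
    ((ratCode q).unpair.1 % 2 = 1 ∨ (ratCode q).unpair.1 ≤ (ratCode q).unpair.2) := by
  have hd : (0 : ℚ) < q.den := by exact_mod_cast q.den_pos
  have h1 : q ≤ 1 / 2 ↔ 2 * q.num ≤ q.den := by
    conv_lhs => rw [← Rat.num_div_den q]
    rw [div_le_div_iff₀ hd (by norm_num)]
    constructor
    · intro h
      have : (2 * q.num : ℚ) ≤ q.den := by linarith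
      exact_mod_cast this
    · intro h
      have : (2 * q.num : ℚ) ≤ q.den := by exact_mod_cast h
      linarith
  rw [h1, ratCode, Nat.unpair_pair]
  rcases hn : q.num with n | n
  · rw [Int.ofNat_eq_natCast, intEquivNat_natCast]; simp; omega
  · rw [intEquivNat_negSucc]; simp; omega

theorem le_half_computable : Computable fun q : ℚ => decide (q ≤ 1 / 2) := by
  have hP : PrimrecPred fun m : ℕ => m.unpair.1 % 2 = 1 ∨ m.unpair.1 ≤ m.unpair.2 := by
    have hden : Primrec fun m : ℕ => m.unpair.2 := Primrec.snd.comp Primrec.unpair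
    have hnum : Primrec fun m : ℕ => m.unpair.1 := Primrec.fst.comp Primrec.unpair
    have a1 : PrimrecPred fun m : ℕ => m.unpair.1 % 2 = 1 :=
      Primrec.eq.comp (Primrec.nat_mod.comp hnum (Primrec.const 2)) (Primrec.const 1)
    exact a1.or (Primrec.nat_le.comp hnum hden)
  refine ((primrecPred_iff_primrec_decide.1 hP).to_comp.comp ratCode_computable).of_eq fun q => ?_
  rw [decide_eq_decide]
  exact (rat_le_half_iff q).symm

/-! ### Existence -/

theorem countable_recursive : {T : Situation → ℝ | IsRecursiveRational T}.Countable := by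
  have hc : Countable {q : Situation → ℚ // Computable q} := by
    let F : {q : Situation → ℚ // Computable q} → {f : ℕ → ℕ // Computable f} := fun q =>
      ⟨fun n => @Encodable.encode (Option ℚ) Primcodable.option.toEncodable ((Encodable.decode n : Option Situation).map q.1),
        Computable.encode.comp (Computable.option_map Computable.decode
          (q.2.comp Computable.snd).to₂)⟩
    refine Function.Injective.countable (f := F) ?_
    rintro ⟨q, hq⟩ ⟨r, hr⟩ h
    refine Subtype.ext (funext fun s => ?_)
    have := congrFun (congrArg Subtype.val h) (Encodable.encode s)
    have h2 := @Encodable.encode_injective (Option ℚ) Primcodable.option.toEncodable _ _ this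
    simpa using h2
  have : {T : Situation → ℝ | IsRecursiveRational T} ⊆
      Set.range (fun (q : {q : Situation → ℚ // Computable q}) (s : Situation) =>
        ((q.1 s : ℚ) : ℝ)) := by
    rintro T ⟨q, hq, h⟩
    exact ⟨⟨q, hq⟩, funext h⟩
  exact (Set.countable_range _).mono this

/-- Situations at which `T` can strictly increase. -/
def badSet (T : Situation → ℝ) : Set Situation := {s | ∃ x, T s < T (s ++ [x])}

/-- Bit assignments that violate the supermartingale property of `T` somewhere. -/
def killSet (T : Situation → ℝ) : Set (Situation → Bool) := {f | ∃ s, T s < T (s ++ [f s])}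

theorem bounded_of_finite (T : Situation → ℝ) (h : (badSet T).Finite) : ∃ C, ∀ s, T s ≤ C := by
  obtain ⟨C, hC⟩ := (h.image fun s => max (T (s ++ [true])) (T (s ++ [false]))).bddAbove
  refine ⟨max C (T []), fun s => ?_⟩
  induction s using List.reverseRecOn with
  | nil => exact le_max_right _ _
  | append_singleton s x ih =>
    by_cases hs : s ∈ badSet T
    · have := hC ⟨s, hs, rfl⟩
      refine le_trans ?_ (le_max_left _ _)
      refine le_trans ?_ this
      cases x
      · exact le_max_right _ _
      · exact le_max_left _ _
    · have : T (s ++ [x]) ≤ T s := by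
        by_contra hcon
        exact hs ⟨x, not_le.1 hcon⟩
      exact this.trans ih

theorem killSet_open (T : Situation → ℝ) : IsOpen (killSet T) := by
  have : killSet T = ⋃ s, (fun f : Situation → Bool => f s) ⁻¹' {x | T s < T (s ++ [x])} := by
    ext f; simp [killSet]
  rw [this]
  exact isOpen_iUnion fun s => (isOpen_discrete _).preimage (continuous_apply s)

theorem killSet_dense (T : Situation → ℝ) (h : (badSet T).Infinite) : Dense (killSet T) := by
  rw [dense_iff_inter_open]
  rintro U hU ⟨f, hf⟩
  obtain ⟨I, u, hu, hsub⟩ := isOpen_pi_iff.1 hU f hf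
  obtain ⟨s, ⟨x, hx⟩, hsI⟩ := h.exists_notMem_finset I
  refine ⟨Function.update f s x, hsub ?_, s, by simpa using hx⟩
  intro i hi
  have : i ≠ s := by rintro rfl; exact hsI hi
  rw [Function.update_of_ne this]
  exact (hu i hi).2

theorem exists_generic : ∃ f : Situation → Bool, ∀ T : Situation → ℝ, IsRecursiveRational T →
    (badSet T).Infinite → f ∈ killSet T := by
  have hc : {T : Situation → ℝ | IsRecursiveRational T ∧ (badSet T).Infinite}.Countable :=
    countable_recursive.mono fun T hT => hT.1
  have hd := dense_biInter_of_isOpen (f := killSet)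
    (fun T (_ : T ∈ {T : Situation → ℝ | IsRecursiveRational T ∧ (badSet T).Infinite}) =>
      killSet_open T) hc (fun T hT => killSet_dense T hT.2)
  obtain ⟨f, hf⟩ := hd.nonempty
  refine ⟨f, fun T h1 h2 => ?_⟩
  simp only [Set.mem_iInter] at hf
  exact hf T ⟨h1, h2⟩

theorem exists_all_random :
    ∃ φ : Situation → ℝ, IsForecastingSystem φ φ ∧ ∀ ω : BinPath, CRandom φ φ ω := by
  obtain ⟨f, hf⟩ := exists_generic
  refine ⟨fun s => bit (f s), fun s => ?_, fun ω T hT _ hS hU => ?_⟩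
  · cases h : f s <;> simp [bit, h]
  · by_cases hbad : (badSet T).Infinite
    · obtain ⟨s, hs⟩ := hf T hT hbad
      have := hS.1 s
      simp only [upperE, max_self, localE, diffP, bit] at this
      cases h : f s
      · rw [h] at hs this
        simp at this
        linarith
      · rw [h] at hs this
        simp at this
        linarith
    · obtain ⟨C, hC⟩ := bounded_of_finite T (Set.not_infinite.1 hbad)
      have : limsup (fun n => ((T (pref ω n) : ℝ) : EReal)) atTop ≤ (C : EReal) :=
        Filter.limsup_le_of_le (h := Eventually.of_forall fun n => by exact_mod_cast hC _)
      rw [hU] at this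
      exact (EReal.coe_lt_top C).not_ge this

/-- there is a precise forecasting system for which every path is
C-random; any such precise forecasting system is non-stationary and
non-computable. -/
theorem statement_6 :
    (∃ φ : Situation → ℝ, IsForecastingSystem φ φ ∧ ∀ ω : BinPath, CRandom φ φ ω) ∧
    (∀ φ : Situation → ℝ, IsForecastingSystem φ φ → (∀ ω : BinPath, CRandom φ φ ω) →
      (¬ ∃ r : ℝ, ∀ s, φ s = r) ∧ ¬ IsComputableProcess φ) := by
  refine ⟨exists_all_random, fun φ _ hall => ⟨?_, ?_⟩⟩
  · rintro ⟨r, hr⟩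
    rcases le_total r (1 / 2) with h | h
    · refine not_all_random φ (fun _ => true) (Computable.const true) ?_ ?_ hall
      · intro s _; rw [hr]; linarith
      · intro s h; simp at h
    · refine not_all_random φ (fun _ => false) (Computable.const false) ?_ ?_ hall
      · intro s h; simp at h
      · intro s _; rw [hr]; linarith
  · rintro ⟨q, hq, h⟩
    have key : ∀ s, |φ s - q s 2| < 1 / 4 := fun s => (h s 2).trans_eq (by norm_num)
    refine not_all_random φ (fun s => decide (q s 2 ≤ 1 / 2))
      (le_half_computable.comp (hq.comp Computable.id (Computable.const 2))) ?_ ?_ hall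
    · intro s hs
      have hs : q s 2 ≤ 1 / 2 := by simpa using hs
      have hs' : ((q s 2 : ℚ) : ℝ) ≤ ((1 / 2 : ℚ) : ℝ) := by exact_mod_cast hs
      push_cast at hs'
      have := abs_lt.1 (key s)
      linarith [this.2]
    · intro s hs
      have hs : 1 / 2 < q s 2 := by simpa using hs
      have hs' : ((1 / 2 : ℚ) : ℝ) < ((q s 2 : ℚ) : ℝ) := by exact_mod_cast hs
      push_cast at hs'
      have := abs_lt.1 (key s)
      linarith [this.1]
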